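/- arXiv:1202.3581 — 2 statements merged into one kernel-verified Lean document; each statement's English description precedes it below -/
import Mathlib

section
/- Let n ≥ 1, let J be a finite set with two distinct elements j₁, j₂ ∈ J, and for each j ∈ J let v_j ∈ ℝⁿ and c_j ∈ ℝ. Let P = {x ∈ ℝⁿ : for all j ∈ J, ⟨x, v_j⟩ ≤ c_j}, where ⟨·,·⟩ denotes the standard inner product on ℝⁿ, and let e₁ be the first standard basis vector of ℝⁿ. Assume that P is nonempty and bounded, that v_{j₁} = e₁, that ⟨v_j, e₁⟩ = 0 for all j ∈ J with j ≠ j₁ and j ≠ j₂, and that ⟨v_{j₂}, e₁⟩ = 1 or ⟨v_{j₂}, e₁⟩ = −1. Then ⟨v_{j₂}, e₁⟩ = −1. -/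
open RealInnerProductSpace

/-- A direction having nonpositive inner product with every normal of a nonempty bounded
polyhedron is zero. -/
theorem eq_zero_of_inner_nonpos_of_isBounded {E J : Type*} [NormedAddCommGroup E]
    [InnerProductSpace ℝ E] {v : J → E} {c : J → ℝ}
    (hne : {x : E | ∀ j, ⟪x, v j⟫ ≤ c j}.Nonempty)
    (hbd : Bornology.IsBounded {x : E | ∀ j, ⟪x, v j⟫ ≤ c j})
    {u : E} (hu : ∀ j, ⟪u, v j⟫ ≤ 0) : u = 0 := by
  obtain ⟨x, hx⟩ := hne
  obtain ⟨R, hR⟩ := hbd.exists_norm_le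
  by_contra h
  have hpos : 0 < ‖u‖ := norm_pos_iff.mpr h
  have hR0 : 0 ≤ R := (norm_nonneg x).trans (hR x hx)
  set t : ℝ := (R + ‖x‖ + 1) / ‖u‖ with ht
  have ht0 : 0 ≤ t := by positivity
  have hmem := hR (x + t • u) fun j => by
    rw [inner_add_left, real_inner_smul_left]
    linarith [hx j, mul_nonpos_of_nonneg_of_nonpos ht0 (hu j)]
  have hnorm : ‖t • u‖ = R + ‖x‖ + 1 := by
    rw [norm_smul, Real.norm_of_nonneg ht0, ht, div_mul_cancel₀ _ hpos.ne']
  have htri : ‖t • u‖ ≤ ‖x + t • u‖ + ‖x‖ := by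
    simpa using norm_sub_le (x + t • u) x
  linarith

/-- Section 5 sign lemma: for a nonempty bounded polyhedron
`P = {x | ∀ j, ⟪x, v j⟫ ≤ c j}` with `v j₁ = e₁`, all other normals (except
possibly `v j₂`) orthogonal to `e₁`, and `⟪v j₂, e₁⟫ = ±1`, boundedness forces
`⟪v j₂, e₁⟫ = -1`. -/
theorem stmt2 (n : ℕ) (hn : 1 ≤ n) (J : Type*) [Finite J]
    (j₁ j₂ : J) (hj : j₁ ≠ j₂)
    (v : J → EuclideanSpace ℝ (Fin n)) (c : J → ℝ)
    (P : Set (EuclideanSpace ℝ (Fin n)))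
    (hP : P = {x | ∀ j : J, ⟪x, v j⟫ ≤ c j})
    (e₁ : EuclideanSpace ℝ (Fin n))
    (he₁ : e₁ = EuclideanSpace.single (⟨0, hn⟩ : Fin n) (1 : ℝ))
    (hne : P.Nonempty) (hbd : Bornology.IsBounded P)
    (hv₁ : v j₁ = e₁)
    (hperp : ∀ j : J, j ≠ j₁ → j ≠ j₂ → ⟪v j, e₁⟫ = 0)
    (hv₂ : ⟪v j₂, e₁⟫ = 1 ∨ ⟪v j₂, e₁⟫ = -1) :
    ⟪v j₂, e₁⟫ = -1 := by
  refine hv₂.resolve_left fun h => ?_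
  have hnorm : ‖e₁‖ = 1 := by simp [he₁]
  subst hP
  have hzero : -e₁ = 0 := eq_zero_of_inner_nonpos_of_isBounded hne hbd fun j => by
    rw [inner_neg_left, real_inner_comm]
    by_cases h₁ : j = j₁
    · rw [h₁, hv₁, real_inner_self_eq_norm_sq, hnorm]
      norm_num
    by_cases h₂ : j = j₂
    · rw [h₂, h]
      norm_num
    · rw [hperp j h₁ h₂, neg_zero]
  rw [neg_eq_zero] at hzero
  simp [hzero] at hnorm
end

section
/- Let n ≥ 2, let J be a finite set, and for each j ∈ J let v_j ∈ ℝⁿ and c_j ∈ ℝ. Assume that each v_j either is equal to one of the standard basis vectors e₁, …, e_n of ℝⁿ or lies in the real linear span of {e₁ − e₂, e₃, …, e_n}. Let P = {x ∈ ℝⁿ : for all j ∈ J, ⟨x, v_j⟩ ≤ c_j}, where ⟨·,·⟩ denotes the standard inner product on ℝⁿ. If P is nonempty, then P is not a bounded subset of ℝⁿ. -/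
open RealInnerProductSpace

/-- A set containing a ray in a nonzero direction is unbounded. -/
theorem not_isBounded_of_ray_subset {E : Type*} [NormedAddCommGroup E] [NormedSpace ℝ E]
    {s : Set E} {x d : E} (hd : d ≠ 0) (h : ∀ t : ℝ, 0 ≤ t → x + t • d ∈ s) :
    ¬ Bornology.IsBounded s := by
  intro hs
  obtain ⟨C, hC⟩ := isBounded_iff_forall_norm_le.mp hs
  have hd' : 0 < ‖d‖ := norm_pos_iff.mpr hd
  have hC0 : 0 ≤ C := (norm_nonneg _).trans (hC _ (h 0 le_rfl))
  have ht : 0 ≤ (C + ‖x‖ + 1) / ‖d‖ := by positivity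
  have h₁ := hC _ (h _ ht)
  have h₂ : ‖((C + ‖x‖ + 1) / ‖d‖) • d‖ = C + ‖x‖ + 1 := by
    rw [norm_smul, Real.norm_of_nonneg ht, div_mul_cancel₀ _ hd'.ne']
  have h₃ := norm_sub_le (x + ((C + ‖x‖ + 1) / ‖d‖) • d) x
  rw [add_sub_cancel_left] at h₃
  linarith

/-- A nonempty polyhedron with a nonzero recession direction is unbounded. -/
theorem not_isBounded_polyhedron {E J : Type*} [NormedAddCommGroup E] [InnerProductSpace ℝ E]
    {v : J → E} {c : J → ℝ} {d : E} (hd : d ≠ 0) (hdv : ∀ j, ⟪d, v j⟫ ≤ 0)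
    (hne : {x | ∀ j, ⟪x, v j⟫ ≤ c j}.Nonempty) :
    ¬ Bornology.IsBounded {x | ∀ j, ⟪x, v j⟫ ≤ c j} := by
  obtain ⟨x, hx⟩ := hne
  refine not_isBounded_of_ray_subset (x := x) hd fun t ht j => ?_
  rw [inner_add_left, real_inner_smul_left]
  linarith [hx j, mul_nonpos_of_nonneg_of_nonpos ht (hdv j)]

/-- Section 5 unboundedness lemma: if every outward normal `v j` is either a
standard basis vector or lies in the span of `{e₁ - e₂, e₃, …, e_n}`, then the
polyhedron `P = {x | ∀ j, ⟪x, v j⟫ ≤ c j}`, if nonempty, is unbounded. -/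
theorem stmt3 (n : ℕ) (hn : 2 ≤ n) (J : Type*) [Finite J]
    (v : J → EuclideanSpace ℝ (Fin n)) (c : J → ℝ)
    (e : Fin n → EuclideanSpace ℝ (Fin n))
    (he : ∀ i : Fin n, e i = EuclideanSpace.single i (1 : ℝ))
    (hv : ∀ j : J, (∃ i : Fin n, v j = e i) ∨
      v j ∈ Submodule.span ℝ
        ({e ⟨0, by omega⟩ - e ⟨1, hn⟩} ∪ {x | ∃ i : Fin n, 2 ≤ (i : ℕ) ∧ x = e i}))
    (P : Set (EuclideanSpace ℝ (Fin n)))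
    (hP : P = {x | ∀ j : J, ⟪x, v j⟫ ≤ c j})
    (hne : P.Nonempty) :
    ¬ Bornology.IsBounded P := by
  subst hP
  have inner_e (i k : Fin n) : ⟪e i, e k⟫ = if i = k then (1 : ℝ) else 0 := by
    simp [he, EuclideanSpace.inner_single_left]
  set a : Fin n := ⟨0, by omega⟩ with ha
  set b : Fin n := ⟨1, hn⟩ with hb
  have hab : a ≠ b := by simp [ha, hb]
  refine not_isBounded_polyhedron (d := -(e a + e b)) ?_ (fun j => ?_) hne
  · intro h
    have h₁ : ⟪-(e a + e b), e a⟫ = (0 : ℝ) := by rw [h, inner_zero_left]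
    simp only [inner_neg_left, inner_add_left, inner_e, hab.symm, if_true, if_false] at h₁
    norm_num at h₁
  · rcases hv j with ⟨i, hi⟩ | hj
    · rw [hi, inner_neg_left, inner_add_left, inner_e, inner_e]
      split_ifs <;> norm_num
    · have hle : Submodule.span ℝ ({e a - e b} ∪ {x | ∃ i : Fin n, 2 ≤ (i : ℕ) ∧ x = e i}) ≤
          (ℝ ∙ -(e a + e b))ᗮ := by
        rw [Submodule.span_le]
        rintro y (rfl | ⟨i, hi, rfl⟩) <;>
          rw [SetLike.mem_coe, Submodule.mem_orthogonal_singleton_iff_inner_right]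
        · simp only [inner_neg_left, inner_add_left, inner_sub_right, inner_e, hab, hab.symm,
            if_true, if_false]
          norm_num
        · have hai : a ≠ i := by rintro rfl; simp [ha] at hi
          have hbi : b ≠ i := by rintro rfl; simp [hb] at hi
          simp [inner_neg_left, inner_add_left, inner_e, hai, hbi]
      exact (Submodule.mem_orthogonal_singleton_iff_inner_right.mp (hle hj)).le
end
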